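/- (Analyticity of the soft-edge matching factor E₁^{(a)} at z = a.) Let a > 0, α > −1 and δ ∈ (0,a). Let ψ̃ be holomorphic on the disk {|z − a| < δ}, real-valued on (a−δ, a+δ), with ψ̃(a) = 0 and ψ̃'(a) > 0. Define, for z in a sufficiently small punctured disk around a with z ∉ (a−δ, a], the 2×2 matrix E₁^{(a)}(z) := D_∞^{σ₃} · M(z) · D(z)^{−σ₃} · z^{ασ₃/2} · U₀^{−1} · ψ̃(z)^{σ₃/4}, where all fractional powers are principal branches. Then E₁^{(a)} extends to a holomorphic matrix-valued function on a full neighborhood of a; in particular its jumps across (a−δ', a) cancel and its singularity at a is removable, for some δ' > 0. -/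

import Mathlib

/-- The exterior conformal map `d(z) = (2/a)z − 1 + (2/a) z^{1/2}(z−a)^{1/2}`,
with principal branches. -/
noncomputable def dmap (a : ℝ) (z : ℂ) : ℂ :=
  (2 / (a : ℂ)) * z - 1 + (2 / (a : ℂ)) * z ^ ((1 : ℂ) / 2) * (z - (a : ℂ)) ^ ((1 : ℂ) / 2)

/-- The constant matrix `U₀ = (1/√2)·[[1, i],[i, 1]]`. -/
noncomputable def Uzero : Matrix (Fin 2) (Fin 2) ℂ :=
  (((Real.sqrt 2 : ℝ) : ℂ))⁻¹ • !![1, Complex.I; Complex.I, 1]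

/-- `w^{γσ₃} = diag(w^γ, w^{−γ})`, with principal branch powers. -/
noncomputable def cpowS3 (w γ : ℂ) : Matrix (Fin 2) (Fin 2) ℂ :=
  !![w ^ γ, 0; 0, w ^ (-γ)]

/-- `M(z) = U₀ ((z−a)/z)^{σ₃/4} U₀⁻¹`. -/
noncomputable def Mmat (a : ℝ) (z : ℂ) : Matrix (Fin 2) (Fin 2) ℂ :=
  Uzero * cpowS3 ((z - (a : ℂ)) / z) (1 / 4) * Uzero⁻¹

/-- `D_∞ = 2^{−α} a^{α/2}`. -/
noncomputable def Dinf (a α : ℝ) : ℝ := (2 : ℝ) ^ (-α) * a ^ (α / 2)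

section PrincipalBranches

open Complex Filter Topology

/-- The principal logarithm is additive on a product `x * y` with `y` in the right half-plane,
provided multiplication by `y` does not move `x` across the real axis. -/
lemma log_mul_of_im_sign {x y : ℂ} (hx : x ∈ slitPlane) (hy : 0 < y.re)
    (hpos : 0 < x.im → 0 < (x * y).im) (hneg : x.im < 0 → (x * y).im < 0) :
    log (x * y) = log x + log y := by
  have hx0 : x ≠ 0 := slitPlane_ne_zero hx
  have hy0 : y ≠ 0 := by rintro rfl; simp at hy
  rw [log_mul_eq_add_log_iff hx0 hy0]
  have hyarg := abs_lt.mp (abs_arg_lt_pi_div_two_iff.mpr (Or.inl hy))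
  have hxy : (x * y).im = Real.exp (log x + log y).re * Real.sin (x.arg + y.arg) := by
    conv_lhs => rw [← exp_log hx0, ← exp_log hy0, ← Complex.exp_add, exp_im]
    simp only [add_im, log_im]
  have hpi := Real.pi_pos
  rcases lt_trichotomy x.im 0 with h | h | h
  · have h1 := hneg h
    have h2 := neg_pi_lt_arg x
    have h3 : x.arg < 0 := arg_neg_iff.mpr h
    refine ⟨?_, by linarith⟩
    by_contra! hcon
    have : 0 ≤ Real.sin (x.arg + y.arg) := by
      rw [← Real.sin_add_two_pi]
      exact Real.sin_nonneg_of_nonneg_of_le_pi (by linarith) (by linarith)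
    have := mul_nonneg (Real.exp_pos (log x + log y).re).le this
    linarith
  · have hre : 0 < x.re := by
      rcases mem_slitPlane_iff.mp hx with h' | h'
      · exact h'
      · exact absurd h h'
    have : x.arg = 0 := arg_eq_zero_iff.mpr ⟨hre.le, h⟩
    rw [this]
    exact ⟨by linarith, by linarith⟩
  · have h1 := hpos h
    have h2 := arg_le_pi x
    have h3 : 0 ≤ x.arg := arg_nonneg_iff.mpr h.le
    refine ⟨by linarith, ?_⟩
    by_contra! hcon
    have : Real.sin (x.arg + y.arg) ≤ 0 := by
      rw [← Real.sin_sub_two_pi]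
      exact Real.sin_nonpos_of_nonpos_of_neg_pi_le (by linarith) (by linarith)
    have := mul_nonpos_of_nonneg_of_nonpos (Real.exp_pos (log x + log y).re).le this
    linarith

lemma log_sub_div_self {a : ℝ} (ha : 0 < a) {z : ℂ} (hz : 0 < z.re) (hza : z - a ∈ slitPlane) :
    log ((z - a) / z) = log (z - a) - log z := by
  have hz0 : z ≠ 0 := by rintro rfl; simp at hz
  have hn : 0 < normSq z := normSq_pos.mpr hz0
  have him : ((z - a) * z⁻¹).im = a * (z - a).im / normSq z := by
    simp [mul_im, inv_im, inv_re]
    field_simp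
    ring
  have hinv : log z⁻¹ = -log z := by
    refine log_inv z fun h => ?_
    have := abs_lt.mp (abs_arg_lt_pi_div_two_iff.mpr (Or.inl hz))
    linarith [Real.pi_pos]
  rw [div_eq_mul_inv, log_mul_of_im_sign hza (by rw [inv_re]; positivity), hinv,
    ← sub_eq_add_neg]
  · intro h
    rw [him]
    positivity
  · intro h
    rw [him]
    exact div_neg_of_neg_of_pos (mul_neg_of_pos_of_neg ha h) hn

/-- A function that is real on the real axis and has positive derivative at a real point
preserves the upper and the lower half-plane near that point. -/
lemma eventually_im_sign {f : ℂ → ℂ} {a : ℝ} {c : ℂ} (hf : HasStrictDerivAt f c a)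
    (hreal : ∀ᶠ x : ℝ in 𝓝 a, (f x).im = 0) (hc : c.im = 0) (hc0 : 0 < c.re) :
    ∀ᶠ z in 𝓝 (a : ℂ), (0 < z.im → 0 < (f z).im) ∧ (z.im < 0 → (f z).im < 0) := by
  have hre : Tendsto (fun z : ℂ => z.re) (𝓝 (a : ℂ)) (𝓝 a) := continuous_re.continuousAt
  have hpair : Tendsto (fun z : ℂ => (z, (z.re : ℂ))) (𝓝 (a : ℂ)) (𝓝 ((a : ℂ), (a : ℂ))) := by
    have : Continuous fun z : ℂ => (z, (z.re : ℂ)) := by fun_prop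
    simpa using this.tendsto (a : ℂ)
  have hlo := hpair.eventually ((hasDerivAtFilter_iff_isLittleO.mp hf).def (half_pos hc0))
  filter_upwards [hlo, hre.eventually hreal] with z h1 h2
  have hz : z - (z.re : ℂ) = z.im * I := by
    apply Complex.ext <;> simp
  simp only [hz] at h1
  have h3 := (abs_im_le_norm _).trans h1
  simp [h2, hc] at h3
  constructor
  · intro h
    rw [abs_of_pos h] at h3
    nlinarith [abs_le.mp h3]
  · intro h
    rw [abs_of_neg h] at h3
    nlinarith [abs_le.mp h3]

lemma cpow_half_sq (u : ℂ) : (u ^ ((1 : ℂ) / 2)) ^ 2 = u := by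
  rw [one_div]
  exact cpow_ofNat_inv_pow u 2

lemma tendsto_cpow_half : Tendsto (fun u : ℂ => u ^ ((1 : ℂ) / 2)) (𝓝 0) (𝓝 0) := by
  have := (continuousAt_cpow_const_of_re_pos (z := 0) (w := 1 / 2) (by simp) (by simp)).tendsto
  simpa using this

lemma norm_lt_of_sq_norm_lt {w : ℂ} {r : ℝ} (hr : 0 < r) (h : ‖w ^ 2‖ < r ^ 2) : ‖w‖ < r := by
  rw [norm_pow] at h
  exact lt_of_pow_lt_pow_left₀ 2 hr.le h

/-- An even analytic function at the origin is an analytic function of the square. -/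
lemma AnalyticAt.exists_eq_comp_sq {f : ℂ → ℂ} (hf : AnalyticAt ℂ f 0)
    (heven : ∀ᶠ w in 𝓝 0, f (-w) = f w) :
    ∃ G : ℂ → ℂ, AnalyticAt ℂ G 0 ∧ ∀ᶠ w in 𝓝 0, f w = G (w ^ 2) := by
  obtain ⟨r, hr, hball⟩ :=
    Metric.eventually_nhds_iff_ball.mp (hf.eventually_analyticAt.and heven)
  simp only [mem_ball_zero_iff] at hball
  set G : ℂ → ℂ := fun u => f (u ^ ((1 : ℂ) / 2)) with hG
  have hval : ∀ w : ℂ, ‖w ^ 2‖ < r ^ 2 → G (w ^ 2) = f w := by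
    intro w hw
    rcases sq_eq_sq_iff_eq_or_eq_neg.mp (cpow_half_sq (w ^ 2)) with h | h
    · simp only [hG, h]
    · simp only [hG, h]
      exact (hball w (norm_lt_of_sq_norm_lt hr hw)).2
  have hdiff : ∀ (s : ℂ → ℂ) (u : ℂ), (∀ v, s v ^ 2 = v) → DifferentiableAt ℂ s u →
      ‖u‖ < r ^ 2 → DifferentiableAt ℂ G u := by
    intro s u hs hsu hu
    have hfs : DifferentiableAt ℂ f (s u) :=
      (hball _ (norm_lt_of_sq_norm_lt hr (by rwa [hs]))).1.differentiableAt
    refine (hfs.comp u hsu).congr_of_eventuallyEq ?_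
    filter_upwards [continuous_norm.continuousAt.eventually_lt continuousAt_const hu] with v hv
    have := hval (s v) (by rwa [hs])
    rwa [hs] at this
  refine ⟨G, analyticAt_of_differentiable_on_punctured_nhds_of_continuousAt ?_ ?_, ?_⟩
  · have hsmall : ∀ᶠ u : ℂ in 𝓝 0, ‖u‖ < r ^ 2 :=
      continuous_norm.continuousAt.eventually_lt continuousAt_const (by simpa using pow_pos hr 2)
    filter_upwards [nhdsWithin_le_nhds hsmall, self_mem_nhdsWithin] with u hu hu0
    by_cases hslit : u ∈ slitPlane
    · exact hdiff _ u cpow_half_sq (differentiableAt_id.cpow (differentiableAt_const _) hslit) hu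
    · have hneg : -u ∈ slitPlane := by
        rw [mem_slitPlane_iff] at hslit ⊢
        push Not at hslit
        left
        have : u.re ≠ 0 := fun h => hu0 (Complex.ext h hslit.2)
        simpa using lt_of_le_of_ne hslit.1 this
      refine hdiff (fun v => I * (-v) ^ ((1 : ℂ) / 2)) u (fun v => ?_) ?_ hu
      · rw [mul_pow, cpow_half_sq, I_sq]
        ring
      · exact (differentiableAt_id.neg.cpow (differentiableAt_const _) hneg).const_mul I
  · have h0 : (0 : ℂ) ^ ((1 : ℂ) / 2) = 0 := by simp
    refine ContinuousAt.comp ?_ ?_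
    · rw [h0]
      exact hf.continuousAt
    · simpa only [ContinuousAt, h0] using tendsto_cpow_half
  · have : ∀ᶠ w : ℂ in 𝓝 0, ‖w ^ 2‖ < r ^ 2 := by
      have hc : Continuous fun w : ℂ => ‖w ^ 2‖ := by fun_prop
      exact hc.continuousAt.eventually_lt continuousAt_const (by simpa using pow_pos hr 2)
    filter_upwards [this] with w hw
    exact (hval w hw).symm

lemma AnalyticAt.dslope_self {f : ℂ → ℂ} {c : ℂ} (hf : AnalyticAt ℂ f c) :
    AnalyticAt ℂ (dslope f c) c :=
  let ⟨_, hp⟩ := hf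
  ⟨_, hp.has_fpower_series_dslope_fslope⟩

/-- An odd analytic function at the origin is `w` times an analytic function of `w ^ 2`. -/
lemma AnalyticAt.exists_eq_mul_comp_sq {f : ℂ → ℂ} (hf : AnalyticAt ℂ f 0)
    (hodd : ∀ᶠ w in 𝓝 0, f (-w) = -f w) :
    ∃ K : ℂ → ℂ, AnalyticAt ℂ K 0 ∧ ∀ᶠ w in 𝓝 0, f w = w * K (w ^ 2) := by
  have h0 : f 0 = 0 := self_eq_neg.mp (by simpa using hodd.self_of_nhds)
  have hmul : ∀ w, w * dslope f 0 w = f w := fun w => by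
    simpa [h0] using sub_smul_dslope f 0 w
  obtain ⟨K, hK, hKeq⟩ := hf.dslope_self.exists_eq_comp_sq (by
    filter_upwards [hodd] with w hw
    rcases eq_or_ne w 0 with rfl | hw0
    · simp
    · apply mul_left_cancel₀ hw0
      linear_combination -hmul (-w) - hmul w - hw)
  refine ⟨K, hK, ?_⟩
  filter_upwards [hKeq] with w hw
  rw [← hw, hmul]

/-- The pullback of `dmap a` under the uniformizing substitution `z = a + w ^ 2`. -/
noncomputable def dmapLift (a : ℝ) (w : ℂ) : ℂ :=
  (2 / (a : ℂ)) * (a + w ^ 2) - 1 + (2 / (a : ℂ)) * (a + w ^ 2) ^ ((1 : ℂ) / 2) * w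

lemma dmapLift_cpow_half (a : ℝ) (z : ℂ) :
    dmapLift a ((z - a) ^ ((1 : ℂ) / 2)) = dmap a z := by
  simp only [dmapLift, dmap, cpow_half_sq, add_sub_cancel]

lemma dmapLift_zero {a : ℝ} (ha : 0 < a) : dmapLift a 0 = 1 := by
  have : (a : ℂ) ≠ 0 := by exact_mod_cast ha.ne'
  simp only [dmapLift]
  field_simp
  ring

lemma analyticAt_dmapLift {a : ℝ} (ha : 0 < a) : AnalyticAt ℂ (dmapLift a) 0 := by
  have h : AnalyticAt ℂ (fun w : ℂ => ((a : ℂ) + w ^ 2) ^ ((1 : ℂ) / 2)) 0 := by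
    refine AnalyticAt.cpow (by fun_prop) analyticAt_const ?_
    exact Or.inl (by simpa using ha)
  unfold dmapLift
  fun_prop

lemma dmapLift_neg {a : ℝ} (ha : 0 < a) (w : ℂ) : dmapLift a (-w) = (dmapLift a w)⁻¹ := by
  have ha0 : (a : ℂ) ≠ 0 := by exact_mod_cast ha.ne'
  refine eq_inv_of_mul_eq_one_left ?_
  have h := cpow_half_sq ((a : ℂ) + w ^ 2)
  simp only [dmapLift, neg_sq]
  generalize ((a : ℂ) + w ^ 2) ^ ((1 : ℂ) / 2) = t at h
  field_simp
  linear_combination (-4 * w ^ 2) * h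

lemma eventually_dmapLift_mem_slitPlane {a : ℝ} (ha : 0 < a) :
    ∀ᶠ w in 𝓝 0, dmapLift a w ∈ slitPlane :=
  (analyticAt_dmapLift ha).continuousAt.eventually_mem
    (isOpen_slitPlane.mem_nhds (by simp [dmapLift_zero ha]))

lemma exists_cosh_sinh_log_dmapLift {a : ℝ} (ha : 0 < a) (β : ℂ) :
    ∃ C K : ℂ → ℂ, AnalyticAt ℂ C 0 ∧ AnalyticAt ℂ K 0 ∧ ∀ᶠ w in 𝓝 0,
      cosh (log (dmapLift a w) * β) = C (w ^ 2) ∧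
      sinh (log (dmapLift a w) * β) = w * K (w ^ 2) := by
  have hL : AnalyticAt ℂ (fun w => log (dmapLift a w) * β) 0 :=
    ((analyticAt_dmapLift ha).clog (by simp [dmapLift_zero ha])).mul analyticAt_const
  have hodd : ∀ᶠ w in 𝓝 0, log (dmapLift a (-w)) * β = -(log (dmapLift a w) * β) := by
    filter_upwards [eventually_dmapLift_mem_slitPlane ha] with w hw
    rw [dmapLift_neg ha, log_inv _ (mem_slitPlane_iff_arg.mp hw).1, neg_mul]
  obtain ⟨C, hC, hCeq⟩ := AnalyticAt.exists_eq_comp_sq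
    (f := fun w => cosh (log (dmapLift a w) * β))
    (analyticAt_cosh.fun_comp hL)
    (hodd.mono fun w hw => by simp only [hw, cosh_neg])
  obtain ⟨K, hK, hKeq⟩ := AnalyticAt.exists_eq_mul_comp_sq
    (f := fun w => sinh (log (dmapLift a w) * β))
    (analyticAt_sinh.fun_comp hL)
    (hodd.mono fun w hw => by simp only [hw, sinh_neg])
  exact ⟨C, K, hC, hK, hCeq.and hKeq⟩

lemma ofReal_sqrt_two_inv_mul_self :
    (((Real.sqrt 2 : ℝ) : ℂ))⁻¹ * (((Real.sqrt 2 : ℝ) : ℂ))⁻¹ = 1 / 2 := by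
  rw [← mul_inv, ← ofReal_mul, Real.mul_self_sqrt (by norm_num)]
  norm_num

lemma Uzero_inv :
    Uzero⁻¹ = (((Real.sqrt 2 : ℝ) : ℂ))⁻¹ • !![1, -I; -I, 1] := by
  refine Matrix.inv_eq_right_inv ?_
  rw [Uzero, Matrix.smul_mul, Matrix.mul_smul, smul_smul,
    ofReal_sqrt_two_inv_mul_self]
  ext i j
  fin_cases i <;> fin_cases j <;> simp <;> norm_num

lemma Uzero_inv_mul_diagonal_mul_Uzero_inv (e : ℂ) :
    Uzero⁻¹ * !![e, 0; 0, e⁻¹] * Uzero⁻¹ =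
      !![(e - e⁻¹) / 2, -I * ((e + e⁻¹) / 2); -I * ((e + e⁻¹) / 2), -((e - e⁻¹) / 2)] := by
  rw [Uzero_inv, Matrix.smul_mul, Matrix.smul_mul, Matrix.mul_smul, smul_smul,
    ofReal_sqrt_two_inv_mul_self]
  ext i j
  fin_cases i <;> fin_cases j <;> simp <;> ring_nf <;>
    simp <;> ring

/-- The part of the matching factor to the right of `D_∞^{σ₃} U₀`, expressed through
`p = z^{1/4}`, `r = (ψ̃(z)/(z-a))^{1/4}`, `x = z - a`, and the even and odd parts `C`,
`x^{1/2} K` of `d(z)^{α/2}`. -/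
noncomputable def innerFactor (p r x C K : ℂ) : Matrix (Fin 2) (Fin 2) ℂ :=
  !![x * K * r / p, -I * (C / (p * r)); -I * (p * r * C), -(p * K / r)]

lemma diagonal_conj_eq_innerFactor {p q r e C K : ℂ} (hp : p ≠ 0) (hq : q ≠ 0) (hr : r ≠ 0)
    (hC : (e + e⁻¹) / 2 = C) (hK : (e - e⁻¹) / 2 = q ^ 2 * K) :
    !![q / p, 0; 0, (q / p)⁻¹] * (Uzero⁻¹ * !![e, 0; 0, e⁻¹] * Uzero⁻¹) *
      !![q * r, 0; 0, (q * r)⁻¹] = innerFactor p r (q ^ 4) C K := by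
  rw [Uzero_inv_mul_diagonal_mul_Uzero_inv, hC, hK, innerFactor]
  ext i j
  fin_cases i <;> fin_cases j <;> simp [Matrix.mul_apply, Fin.sum_univ_two] <;> field_simp

lemma analyticAt_innerFactor {p r x C K : ℂ → ℂ} {z : ℂ} (hp : AnalyticAt ℂ p z)
    (hr : AnalyticAt ℂ r z) (hx : AnalyticAt ℂ x z) (hC : AnalyticAt ℂ C z)
    (hK : AnalyticAt ℂ K z) (hp0 : p z ≠ 0) (hr0 : r z ≠ 0) (i j : Fin 2) :
    AnalyticAt ℂ (fun w => innerFactor (p w) (r w) (x w) (C w) (K w) i j) z := by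
  have h1 := ((hx.mul hK).mul hr).div hp hp0
  have h2 := (analyticAt_const (v := -I)).mul (hC.div (hp.mul hr) (mul_ne_zero hp0 hr0))
  have h3 := (analyticAt_const (v := -I)).mul ((hp.mul hr).mul hC)
  have h4 := ((hp.mul hK).div hr hr0).neg
  fin_cases i <;> fin_cases j
  exacts [h1, h2, h3, h4]

lemma cpowS3_eq_of_log {w γ t : ℂ} (hw : w ≠ 0) (h : exp (log w * γ) = t) :
    cpowS3 w γ = !![t, 0; 0, t⁻¹] := by
  rw [cpowS3, cpow_neg, cpow_def_of_ne_zero hw, h]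

lemma mul_sub_dslope {f : ℂ → ℂ} {c : ℂ} (hf : f c = 0) (z : ℂ) :
    (z - c) * dslope f c z = f z := by
  simpa [hf] using sub_smul_dslope f c z

/-- The local factorization of the matching factor away from the cut. -/
lemma matching_factor_eq {a : ℝ} (ha : 0 < a) {β z d y ψ g C K Δ : ℂ} (hz : 0 < z.re)
    (hza : z - a ∈ slitPlane) (hd : d ≠ 0) (hy : y = z ^ β / d ^ β) (hg : 0 < g.re)
    (hψ : (z - a) * g = ψ) (hpos : 0 < z.im → 0 < ψ.im) (hneg : z.im < 0 → ψ.im < 0)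
    (hC : cosh (log d * β) = C) (hK : sinh (log d * β) = (z - a) ^ ((1 : ℂ) / 2) * K) :
    !![Δ, 0; 0, Δ⁻¹] * Mmat a z * !![y⁻¹, 0; 0, y] * cpowS3 z β * Uzero⁻¹ *
        cpowS3 ψ (1 / 4) =
      !![Δ, 0; 0, Δ⁻¹] * Uzero *
        innerFactor (exp (log z * (1 / 4))) (exp (log g * (1 / 4))) (z - a) C K := by
  have hz0 : z ≠ 0 := by rintro rfl; simp at hz
  have hg0 : g ≠ 0 := by rintro rfl; simp at hg
  have hza0 : z - a ≠ 0 := slitPlane_ne_zero hza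
  set q := exp (log (z - a) * (1 / 4)) with hq
  have hq2 : q ^ 2 = (z - a) ^ ((1 : ℂ) / 2) := by
    rw [cpow_def_of_ne_zero hza0, hq, ← Complex.exp_nat_mul]
    congr 1
    push_cast
    ring
  have hq4 : q ^ 4 = z - a := by
    rw [show q ^ 4 = (q ^ 2) ^ 2 by ring, hq2, cpow_half_sq]
  have hM : cpowS3 ((z - a) / z) (1 / 4) =
      !![q / exp (log z * (1 / 4)), 0; 0, (q / exp (log z * (1 / 4)))⁻¹] := by
    refine cpowS3_eq_of_log (div_ne_zero hza0 hz0) ?_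
    rw [log_sub_div_self ha hz hza, sub_mul, Complex.exp_sub]
  have hP : cpowS3 ψ (1 / 4) =
      !![q * exp (log g * (1 / 4)), 0; 0, (q * exp (log g * (1 / 4)))⁻¹] := by
    refine cpowS3_eq_of_log (hψ ▸ mul_ne_zero hza0 hg0) ?_
    rw [← hψ, log_mul_of_im_sign hza hg (by simpa [hψ] using hpos) (by simpa [hψ] using hneg),
      add_mul, Complex.exp_add]
  have hD : !![y⁻¹, 0; 0, y] * cpowS3 z β =
      !![exp (log d * β), 0; 0, (exp (log d * β))⁻¹] := by
    have hzβ : z ^ β ≠ 0 := by simp [cpow_eq_zero_iff, hz0]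
    rw [cpowS3_eq_of_log (t := z ^ β) hz0 (cpow_def_of_ne_zero hz0 β).symm, hy,
      ← cpow_def_of_ne_zero hd]
    ext i j
    fin_cases i <;> fin_cases j <;> simp [Matrix.mul_apply, Fin.sum_univ_two] <;> field_simp
  have key := diagonal_conj_eq_innerFactor (exp_ne_zero (log z * (1 / 4)))
    (exp_ne_zero (log (z - a) * (1 / 4))) (exp_ne_zero (log g * (1 / 4)))
    (e := exp (log d * β)) (C := C) (K := K)
    (by rw [← hC, cosh, Complex.exp_neg]) (by rw [← hq, hq2, ← hK, sinh, Complex.exp_neg])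
  rw [← hq, hq4] at key
  rw [← key, Mmat, hM, hP, ← hD]
  simp only [Matrix.mul_assoc]

end PrincipalBranches

open Complex Filter Topology in
/-- Analyticity of the soft-edge matching factor `E₁^{(a)}` at `z = a`:
`E₁^{(a)}(z) = D_∞^{σ₃} M(z) D(z)^{−σ₃} z^{ασ₃/2} U₀⁻¹ ψ̃(z)^{σ₃/4}` extends
holomorphically to a full neighborhood of `a`. -/
theorem statement18 (a α δ : ℝ) (ha : 0 < a) (hα : -1 < α) (hδ : 0 < δ) (hδa : δ < a)
    (D ψt : ℂ → ℂ)
    (hD : DifferentiableOn ℂ D {z : ℂ | ¬(z.im = 0 ∧ 0 ≤ z.re ∧ z.re ≤ a)})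
    (hDeq : ∀ z : ℂ, ¬(z.im = 0 ∧ z.re ≤ a) →
      D z = z ^ ((α : ℂ) / 2) / (dmap a z) ^ ((α : ℂ) / 2))
    -- ψ̃ is holomorphic near a, real on (a−δ,a+δ), with ψ̃(a) = 0 and ψ̃'(a) > 0
    (hψ : DifferentiableOn ℂ ψt (Metric.ball (a : ℂ) δ))
    (hψreal : ∀ x : ℝ, |x - a| < δ → (ψt (x : ℂ)).im = 0)
    (hψ0 : ψt (a : ℂ) = 0)
    (hψ' : ∃ c : ℂ, HasDerivAt ψt c (a : ℂ) ∧ c.im = 0 ∧ 0 < c.re) :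
    ∃ (δ' : ℝ) (E : ℂ → Matrix (Fin 2) (Fin 2) ℂ), 0 < δ' ∧ δ' < δ ∧
      (∀ i j : Fin 2, DifferentiableOn ℂ (fun z => E z i j) (Metric.ball (a : ℂ) δ')) ∧
      ∀ z ∈ Metric.ball ((a : ℝ) : ℂ) δ', ¬(z.im = 0 ∧ z.re ≤ a) →
        E z = !![((Dinf a α : ℝ) : ℂ), 0; 0, (((Dinf a α : ℝ) : ℂ))⁻¹] * Mmat a z *
            !![(D z)⁻¹, 0; 0, D z] * cpowS3 z ((α : ℂ) / 2) * Uzero⁻¹ *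
            cpowS3 (ψt z) (1 / 4) := by
  obtain ⟨c, hc, hcim, hcre⟩ := hψ'
  have hψan : AnalyticAt ℂ ψt a := hψ.analyticAt (Metric.ball_mem_nhds _ hδ)
  have hstrict : HasStrictDerivAt ψt c a := hc.deriv ▸ hψan.hasStrictDerivAt
  set g : ℂ → ℂ := dslope ψt a with hg
  have hgan : AnalyticAt ℂ g a := hψan.dslope_self
  have hga : g a = c := by rw [hg, dslope_same, hc.deriv]
  have hgslit : g a ∈ slitPlane := by rw [hga]; exact Or.inl hcre
  obtain ⟨C, K, hC, hK, hCK⟩ := exists_cosh_sinh_log_dmapLift ha ((α : ℂ) / 2)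
  have hsub : AnalyticAt ℂ (fun z : ℂ => z - a) a := by fun_prop
  have hsub0 : Tendsto (fun z : ℂ => z - a) (𝓝 (a : ℂ)) (𝓝 0) := by
    simpa using hsub.continuousAt.tendsto
  have hsqrt := tendsto_cpow_half.comp hsub0
  have haslit : (a : ℂ) ∈ slitPlane := Or.inl (by simpa using ha)
  let E : ℂ → Matrix (Fin 2) (Fin 2) ℂ := fun z =>
    !![((Dinf a α : ℝ) : ℂ), 0; 0, (((Dinf a α : ℝ) : ℂ))⁻¹] * Uzero *
      innerFactor (exp (log z * (1 / 4))) (exp (log (g z) * (1 / 4))) (z - a)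
        (C (z - a)) (K (z - a))
  have hN : ∀ i j, AnalyticAt ℂ (fun z => innerFactor (exp (log z * (1 / 4)))
      (exp (log (g z) * (1 / 4))) (z - a) (C (z - a)) (K (z - a)) i j) a :=
    analyticAt_innerFactor (((analyticAt_id.clog haslit).mul analyticAt_const).cexp)
      (((hgan.clog hgslit).mul analyticAt_const).cexp) hsub
      (AnalyticAt.fun_comp (by simpa using hC) hsub) (AnalyticAt.fun_comp (by simpa using hK) hsub)
      (exp_ne_zero _) (exp_ne_zero _)
  have hE : ∀ i j, AnalyticAt ℂ (fun z => E z i j) a := fun i j => by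
    simp only [E, Matrix.mul_apply (M := _ * Uzero), Fin.sum_univ_two]
    exact (analyticAt_const.mul (hN 0 j)).add (analyticAt_const.mul (hN 1 j))
  have hEan : ∀ᶠ z in 𝓝 (a : ℂ), ∀ i j, AnalyticAt ℂ (fun z => E z i j) z :=
    eventually_all.mpr fun i => eventually_all.mpr fun j => (hE i j).eventually_analyticAt
  have hreal : ∀ᶠ x : ℝ in 𝓝 a, (ψt x).im = 0 := by
    filter_upwards [Metric.ball_mem_nhds a hδ] with x hx
    exact hψreal x (by simpa [Real.dist_eq] using hx)
  have hzre : ∀ᶠ z in 𝓝 (a : ℂ), 0 < z.re :=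
    continuousAt_const.eventually_lt continuous_re.continuousAt (by simpa using ha)
  have hgre : ∀ᶠ z in 𝓝 (a : ℂ), 0 < (g z).re :=
    continuousAt_const.eventually_lt (continuous_re.continuousAt.comp hgan.continuousAt)
      (by simpa [hga] using hcre)
  have hEeq : ∀ᶠ z in 𝓝 (a : ℂ), ¬(z.im = 0 ∧ z.re ≤ a) →
      E z = !![((Dinf a α : ℝ) : ℂ), 0; 0, (((Dinf a α : ℝ) : ℂ))⁻¹] * Mmat a z *
        !![(D z)⁻¹, 0; 0, D z] * cpowS3 z ((α : ℂ) / 2) * Uzero⁻¹ *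
        cpowS3 (ψt z) (1 / 4) := by
    filter_upwards [hzre, hgre, hsqrt.eventually hCK,
      hsqrt.eventually (eventually_dmapLift_mem_slitPlane ha),
      eventually_im_sign hstrict hreal hcim hcre] with z h1 h2 h3 h4 h5 hcut
    have hza : z - a ∈ slitPlane := by
      rw [mem_slitPlane_iff]
      by_contra! h
      exact hcut ⟨by simpa using h.2, by simpa using h.1⟩
    simp only [Function.comp_apply, dmapLift_cpow_half, cpow_half_sq] at h3 h4
    exact (matching_factor_eq ha h1 hza (slitPlane_ne_zero h4) (hDeq z hcut) h2
      (mul_sub_dslope hψ0 z) h5.1 h5.2 h3.1 h3.2).symm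
  obtain ⟨ε, hε, hball⟩ := Metric.eventually_nhds_iff_ball.mp (hEan.and hEeq)
  refine ⟨min ε (δ / 2), E, lt_min hε (half_pos hδ),
    (min_le_right _ _).trans_lt (half_lt_self hδ), fun i j z hz => ?_, fun z hz => ?_⟩
  · have hz' := Metric.ball_subset_ball (min_le_left _ _) hz
    exact ((hball z hz').1 i j).differentiableAt.differentiableWithinAt
  · exact (hball z (Metric.ball_subset_ball (min_le_left _ _) hz)).2
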